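/- arXiv:2002.00512 — 6 statements merged into one kernel-verified Lean document; each statement's English description precedes it below -/
import Mathlib

section
/- Let a > 0 and let ω be a smooth cutoff function supported in [0, a). Let j ≥ 0 be an integer. If j is odd, then for every positive integer n, ∫_0^a ω(r) r^(j+2) · (sin(K r)/(K r)) dr = (−1)^((j+1)/2) (j+1)! / K^(j+3) + o(K^(−n)) as K → +∞. If j is even, then for every positive integer n, ∫_0^a ω(r) r^(j+2) · (sin(K r)/(K r)) dr = o(K^(−n)) as K → +∞. -/
open MeasureTheory Filter Asymptotics

/-- One integration by parts. -/
lemma aux_ibp (a : ℝ) (f : ℝ → ℂ) (hf : ContDiff ℝ (⊤ : ℕ∞) f) (hfa : f a = 0)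
    (K : ℝ) (hK : 0 < K) :
    (∫ r in (0:ℝ)..a, f r * Complex.exp (Complex.I * K * r)) =
      (Complex.I / K) * (f 0 + ∫ r in (0:ℝ)..a, deriv f r * Complex.exp (Complex.I * K * r)) := by
  have hKc : (K : ℂ) ≠ 0 := by exact_mod_cast hK.ne'
  have hd : Differentiable ℝ f := hf.differentiable (by simp)
  have hdc : Continuous (deriv f) := hf.continuous_deriv (by simp)
  have hv : ∀ x : ℝ, HasDerivAt (fun r : ℝ => Complex.exp (Complex.I * K * r) / (Complex.I * K))
      (Complex.exp (Complex.I * K * x)) x := by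
    intro x
    have h1 : HasDerivAt (fun r : ℝ => Complex.I * K * (r : ℂ)) (Complex.I * K * 1) x :=
      (Complex.ofRealCLM.hasDerivAt (x := x)).const_mul (Complex.I * (K:ℂ))
    have h2 := (h1.cexp).div_const (Complex.I * K)
    rw [mul_one, mul_div_assoc, div_self (mul_ne_zero Complex.I_ne_zero hKc), mul_one] at h2
    exact h2
  have h := intervalIntegral.integral_mul_deriv_eq_deriv_mul (a := 0) (b := a)
    (u := f) (u' := deriv f)
    (fun x _ => (hd x).hasDerivAt) (fun x _ => hv x)
    (hdc.intervalIntegrable _ _) ((by fun_prop : Continuous fun x : ℝ => Complex.exp (Complex.I * K * x)).intervalIntegrable _ _)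
  rw [h, hfa]
  have h3 : (∫ x in (0:ℝ)..a, deriv f x * (Complex.exp (Complex.I * K * x) / (Complex.I * K)))
      = (∫ x in (0:ℝ)..a, deriv f x * Complex.exp (Complex.I * K * x)) / (Complex.I * K) := by
    rw [← intervalIntegral.integral_div]
    congr 1; ext x; ring
  rw [h3]
  have hI : Complex.I * Complex.I = -1 := Complex.I_mul_I
  have e : ∀ z : ℂ, z / (Complex.I * K) = -(Complex.I / K) * z := by
    intro z
    rw [div_eq_iff (mul_ne_zero Complex.I_ne_zero hKc)]
    field_simp
    linear_combination z * Complex.I_sq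
  simp only [e]
  simp
  ring

lemma aux_main (a δ b : ℝ) (ha : 0 < a) (hδ : 0 < δ) (hb : b < a) (N : ℕ) :
    ∀ (m : ℕ) (c : ℂ) (f : ℝ → ℂ), ContDiff ℝ (⊤ : ℕ∞) f →
      (∀ r ∈ Set.Ioo (0:ℝ) δ, f r = c * (r:ℂ) ^ m) → (∀ r : ℝ, b < r → f r = 0) →
      ∃ M : ℝ, ∀ K : ℝ, 1 ≤ K →
        ‖(∫ r in (0:ℝ)..a, f r * Complex.exp (Complex.I * K * r))
          - c * (m.factorial : ℂ) * (Complex.I / K) ^ (m + 1)‖ ≤ M / K ^ N := by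
  induction N with
  | zero =>
    intro m c f hf _ _
    refine ⟨(∫ r in (0:ℝ)..a, ‖f r‖) + ‖c * (m.factorial : ℂ)‖, fun K hK => ?_⟩
    rw [pow_zero, div_one]
    refine (norm_sub_le _ _).trans (add_le_add ?_ ?_)
    · refine (intervalIntegral.norm_integral_le_integral_norm ha.le).trans (le_of_eq ?_)
      congr 1; ext r
      rw [norm_mul, show Complex.I * K * r = ((K * r : ℝ) : ℂ) * Complex.I by push_cast; ring,
        Complex.norm_exp_ofReal_mul_I, mul_one]
    · rw [norm_mul _ (_ ^ _)]
      refine mul_le_of_le_one_right (norm_nonneg _) ?_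
      rw [norm_pow]
      refine pow_le_one₀ (norm_nonneg _) ?_
      rw [norm_div, Complex.norm_I, Complex.norm_real, Real.norm_of_nonneg (by linarith)]
      exact (div_le_one (by linarith)).2 hK
  | succ N ih =>
    intro m c f hf h0 hz
    have hf' : ContDiff ℝ (⊤ : ℕ∞) (deriv f) := by
      have : ContDiff ℝ (((⊤ : ℕ∞) : WithTop ℕ∞) + 1) f := by simpa using hf
      exact (contDiff_succ_iff_deriv.1 this).2.2
    have hz' : ∀ r : ℝ, b < r → deriv f r = 0 := by
      intro r hr
      have : f =ᶠ[nhds r] fun _ => 0 := by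
        filter_upwards [Ioi_mem_nhds hr] with x hx using hz x hx
      rw [this.deriv_eq]; simp
    have h0' : ∀ r ∈ Set.Ioo (0:ℝ) δ, deriv f r = (c * m) * (r:ℂ) ^ (m - 1) := by
      intro r hr
      have : f =ᶠ[nhds r] fun x : ℝ => c * (x:ℂ) ^ m := by
        filter_upwards [Ioo_mem_nhds hr.1 hr.2] with x hx using h0 x hx
      rw [this.deriv_eq]
      have h1 := (((Complex.ofRealCLM.hasDerivAt (x := r))).pow m).const_mul c
      have h2 : HasDerivAt (fun x : ℝ => c * (x:ℂ) ^ m) _ r := h1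
      rw [h2.deriv]
      simp
      ring
    have hf0 : f 0 = c * (0:ℂ) ^ m := by
      have t1 : Tendsto f (nhdsWithin 0 (Set.Ioi 0)) (nhds (f 0)) :=
        (hf.continuous.tendsto 0).mono_left nhdsWithin_le_nhds
      have hc : Continuous (fun x : ℝ => c * (x:ℂ) ^ m) := by fun_prop
      have t2 : Tendsto (fun x : ℝ => c * (x:ℂ) ^ m) (nhdsWithin 0 (Set.Ioi 0))
          (nhds (c * ((0:ℝ):ℂ) ^ m)) :=
        (hc.tendsto 0).mono_left nhdsWithin_le_nhds
      have : f =ᶠ[nhdsWithin 0 (Set.Ioi 0)] fun x : ℝ => c * (x:ℂ) ^ m := by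
        filter_upwards [Ioo_mem_nhdsGT hδ] with x hx using h0 x hx
      simpa using tendsto_nhds_unique (t1.congr' this) t2
    obtain ⟨M, hM⟩ := ih (m - 1) (c * m) (deriv f) hf' h0' hz'
    refine ⟨M, fun K hK => ?_⟩
    have hK0 : 0 < K := by linarith
    have key : (∫ r in (0:ℝ)..a, f r * Complex.exp (Complex.I * K * r))
          - c * (m.factorial : ℂ) * (Complex.I / K) ^ (m + 1)
        = (Complex.I / K) * ((∫ r in (0:ℝ)..a, deriv f r * Complex.exp (Complex.I * K * r))
          - (c * m) * ((m-1).factorial : ℂ) * (Complex.I / K) ^ (m - 1 + 1)) := by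
      rw [aux_ibp a f hf (hz a hb) K hK0, hf0]
      rcases m with _ | m
      · simp; ring
      · simp [Nat.factorial_succ]; ring
    rw [key, norm_mul, norm_div, Complex.norm_I, Complex.norm_real, Real.norm_of_nonneg hK0.le]
    calc _ ≤ 1 / K * (M / K ^ N) := by gcongr; exact hM K hK
      _ = _ := by rw [pow_succ]; field_simp

lemma aux_real (a : ℝ) (ha : 0 < a) (ω : ℝ → ℝ)
    (hω : ContDiff ℝ (⊤ : ℕ∞) ω)
    (hcut : ∃ δ b : ℝ, 0 < δ ∧ δ < b ∧ b < a ∧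
      (∀ r ∈ Set.Icc (0:ℝ) δ, ω r = 1) ∧ ∀ r : ℝ, b ≤ r → ω r = 0)
    (j : ℕ) (n : ℕ) :
    (fun K : ℝ => (∫ r in (0:ℝ)..a, ω r * r ^ (j + 2) * (Real.sin (K * r) / (K * r)))
        - (Complex.I ^ (j + 2)).im * (Nat.factorial (j + 1)) / K ^ (j + 3))
      =o[atTop] fun K : ℝ => K ^ (-(n : ℤ)) := by
  obtain ⟨δ, b, hδ, -, hb, h1, hz⟩ := hcut
  have hsm : ContDiff ℝ (⊤ : ℕ∞) (fun r : ℝ => ((ω r * r ^ (j + 1) : ℝ) : ℂ)) :=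
    Complex.ofRealCLM.contDiff.comp (hω.mul (contDiff_id.pow (j + 1)))
  obtain ⟨M, hM⟩ := aux_main a δ b ha hδ hb n (j + 1) 1
    (fun r : ℝ => ((ω r * r ^ (j + 1) : ℝ) : ℂ)) hsm
    (fun r hr => by simp [h1 r ⟨hr.1.le, hr.2.le⟩]) (fun r hr => by simp [hz r hr.le])
  have hO : (fun K : ℝ => (∫ r in (0:ℝ)..a, ω r * r ^ (j + 2) * (Real.sin (K * r) / (K * r)))
        - (Complex.I ^ (j + 2)).im * (Nat.factorial (j + 1)) / K ^ (j + 3))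
      =O[atTop] fun K : ℝ => K ^ (-((n + 1 : ℕ) : ℤ)) := by
    refine IsBigO.of_bound M ?_
    filter_upwards [eventually_ge_atTop 1] with K hK
    have hK0 : 0 < K := by linarith
    have hint : (∫ r in (0:ℝ)..a, ω r * r ^ (j + 2) * (Real.sin (K * r) / (K * r)))
        = (∫ r in (0:ℝ)..a, ((ω r * r ^ (j + 1) : ℝ) : ℂ) * Complex.exp (Complex.I * K * r)).im
          / K := by
      have hc : Continuous fun r : ℝ =>
          ((ω r * r ^ (j + 1) : ℝ) : ℂ) * Complex.exp (Complex.I * K * r) :=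
        hsm.continuous.mul (by fun_prop)
      have := Complex.imCLM.intervalIntegral_comp_comm (hc.intervalIntegrable 0 a (μ := volume))
      simp only [Complex.imCLM_apply] at this
      rw [← this, ← intervalIntegral.integral_div]
      congr 1; ext r
      rw [Complex.im_ofReal_mul,
        show Complex.I * K * r = ((K * r : ℝ) : ℂ) * Complex.I by push_cast; ring,
        Complex.exp_ofReal_mul_I_im]
      rcases eq_or_ne r 0 with rfl | hr
      · simp
      · field_simp
        ring
    have hmain : (Complex.I ^ (j + 2)).im * (Nat.factorial (j + 1)) / K ^ (j + 3)
        = (1 * ((j + 1).factorial : ℂ) * (Complex.I / K) ^ (j + 1 + 1)).im / K := by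
      have : (1 * ((j + 1).factorial : ℂ) * (Complex.I / K) ^ (j + 1 + 1))
          = (((j + 1).factorial / K ^ (j + 2) : ℝ) : ℂ) * Complex.I ^ (j + 2) := by
        push_cast; rw [div_pow]; ring
      rw [this, Complex.im_ofReal_mul]
      field_simp
      ring
    rw [hint, hmain, ← sub_div, ← Complex.sub_im, norm_div, Real.norm_of_nonneg hK0.le,
      zpow_neg, zpow_natCast, norm_inv, norm_pow, Real.norm_of_nonneg hK0.le]
    calc _ ≤ M / K ^ n / K := by
          gcongr
          exact (Complex.abs_im_le_norm _).trans (hM K hK)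
      _ = _ := by rw [pow_succ]; field_simp
  refine hO.trans_isLittleO ?_
  rw [isLittleO_iff_tendsto']
  · refine tendsto_inv_atTop_zero.congr' ?_
    filter_upwards [eventually_gt_atTop 0] with K hK
    simp only [zpow_neg, zpow_natCast, pow_succ]
    field_simp
  · filter_upwards [eventually_gt_atTop 0] with K hK h
    exact absurd h (zpow_ne_zero _ hK.ne')

theorem stmt1 (a : ℝ) (ha : 0 < a) (ω : ℝ → ℝ)
    (hω : ContDiff ℝ (⊤ : ℕ∞) ω)
    (hcut : ∃ δ b : ℝ, 0 < δ ∧ δ < b ∧ b < a ∧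
      (∀ r ∈ Set.Icc (0:ℝ) δ, ω r = 1) ∧ ∀ r : ℝ, b ≤ r → ω r = 0)
    (j : ℕ) (n : ℕ) (hn : 1 ≤ n) :
    (Odd j →
      (fun K : ℝ => (∫ r in (0:ℝ)..a, ω r * r ^ (j + 2) * (Real.sin (K * r) / (K * r)))
          - (-1 : ℝ) ^ ((j + 1) / 2) * (Nat.factorial (j + 1)) / K ^ (j + 3))
        =o[atTop] fun K : ℝ => K ^ (-(n : ℤ))) ∧
    (Even j →
      (fun K : ℝ => ∫ r in (0:ℝ)..a, ω r * r ^ (j + 2) * (Real.sin (K * r) / (K * r)))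
        =o[atTop] fun K : ℝ => K ^ (-(n : ℤ))) := by
  have h := aux_real a ha ω hω hcut j n
  constructor
  · rintro ⟨k, rfl⟩
    have e : (Complex.I ^ (2 * k + 1 + 2)).im = (-1 : ℝ) ^ ((2 * k + 1 + 1) / 2) := by
      rw [show (2 * k + 1 + 1) / 2 = k + 1 by omega,
        show 2 * k + 1 + 2 = 2 * (k + 1) + 1 by ring, pow_succ, pow_mul, Complex.I_sq,
        show ((-1 : ℂ) ^ (k + 1)) = (((-1 : ℝ) ^ (k + 1) : ℝ) : ℂ) by push_cast; rfl,
        Complex.im_ofReal_mul, Complex.I_im, mul_one]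
    rw [e] at h
    exact h
  · rintro ⟨k, rfl⟩
    have e : (Complex.I ^ (k + k + 2)).im = 0 := by
      rw [show k + k + 2 = 2 * (k + 1) by ring, pow_mul, Complex.I_sq,
        show ((-1 : ℂ) ^ (k + 1)) = (((-1 : ℝ) ^ (k + 1) : ℝ) : ℂ) by push_cast; rfl,
        Complex.ofReal_im]
    rw [e] at h
    simpa using h
end

section
/- Let a > 0 and let ω be a smooth cutoff function supported in [0, a). For every integer m ≥ 0 and every positive integer n, the complex-valued integral satisfies ∫_0^a ω(r) r^m e^(i K r) dr = (−1)^(m+1) m! / (i K)^(m+1) + o(K^(−n)) as K → +∞. -/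
open MeasureTheory Filter Asymptotics

/-- The oscillatory integral of g. -/
noncomputable def oscJ (a : ℝ) (g : ℝ → ℂ) (K : ℝ) : ℂ :=
  ∫ r in (0:ℝ)..a, g r * Complex.exp (Complex.I * K * r)

lemma oscJ_parts (a : ℝ) (g g' : ℝ → ℂ) (hg : ∀ r, HasDerivAt g (g' r) r)
    (hg' : Continuous g') (hga : g a = 0) (K : ℝ) (hK : K ≠ 0) :
    oscJ a g K = -(1 / (Complex.I * K)) * (g 0 + oscJ a g' K) := by
  have hc : Complex.I * (K:ℂ) ≠ 0 := by simp [hK]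
  have hv : ∀ r : ℝ, HasDerivAt
      (fun r : ℝ => Complex.exp (Complex.I * K * r) / (Complex.I * K))
      (Complex.exp (Complex.I * K * r)) r := by
    intro r
    have h1 : HasDerivAt (fun r : ℝ => Complex.I * K * (r:ℂ)) (Complex.I * K * 1) r :=
      (Complex.ofRealCLM.hasDerivAt (x := r)).const_mul _
    have h2 := h1.cexp.div_const (Complex.I * K)
    exact h2.congr_deriv (by rw [mul_one, mul_div_cancel_right₀ _ hc])
  have hp := intervalIntegral.integral_mul_deriv_eq_deriv_mul (a := 0) (b := a)
    (u := g) (u' := g') (fun x _ => hg x) (fun x _ => hv x)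
    (hg'.intervalIntegrable _ _)
    ((by fun_prop : Continuous (fun r : ℝ =>
      Complex.exp (Complex.I * K * r))).intervalIntegrable _ _)
  unfold oscJ
  rw [hp, hga]
  have : ∀ r : ℝ, g' r * (Complex.exp (Complex.I * K * r) / (Complex.I * K))
      = (g' r * Complex.exp (Complex.I * K * r)) * (1 / (Complex.I * K)) := by
    intro r; ring
  simp only [this]
  rw [intervalIntegral.integral_mul_const]
  simp
  ring

lemma oscJ_add_const_mul (a : ℝ) (c : ℂ) (f g : ℝ → ℂ) (hf : Continuous f) (hg : Continuous g)
    (K : ℝ) : oscJ a (fun r => c * f r + g r) K = c * oscJ a f K + oscJ a g K := by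
  unfold oscJ
  rw [← intervalIntegral.integral_const_mul, ← intervalIntegral.integral_add]
  · congr 1; ext r; ring
  · exact (by fun_prop : Continuous _).intervalIntegrable _ _
  · exact (by fun_prop : Continuous _).intervalIntegrable _ _

lemma inv_isBigO : (fun K : ℝ => -(1 / (Complex.I * (K:ℂ)))) =O[atTop] fun K : ℝ => K⁻¹ := by
  refine IsBigO.of_bound 1 (Eventually.of_forall fun K => ?_)
  simp

lemma oscJ_bounded (a : ℝ) (ha : 0 < a) (g : ℝ → ℂ) (hg : Continuous g) :
    (oscJ a g) =O[atTop] fun _ : ℝ => (1:ℝ) := by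
  obtain ⟨C, hC⟩ := isCompact_Icc.exists_bound_of_continuousOn (s := Set.Icc 0 a) hg.continuousOn
  refine IsBigO.of_bound (C * |a - 0|) (Eventually.of_forall fun K => ?_)
  simp only [norm_one, mul_one]
  unfold oscJ
  refine intervalIntegral.norm_integral_le_of_norm_le_const fun r hr => ?_
  rw [Set.uIoc_of_le ha.le] at hr
  have : ‖Complex.exp (Complex.I * K * r)‖ = 1 := by
    rw [Complex.norm_exp]; simp
  rw [norm_mul, this, mul_one]
  exact hC r ⟨hr.1.le, hr.2⟩

lemma zero_at_zero (g : ℝ → ℂ) (hg : Continuous g) (δ : ℝ) (hδ : 0 < δ)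
    (h : ∀ r ∈ Set.Ioo 0 δ, g r = 0) : g 0 = 0 := by
  have hs : Set.Ioo 0 δ ⊆ g ⁻¹' {0} := fun r hr => h r hr
  have := closure_minimal hs ((isClosed_singleton).preimage hg)
  rw [closure_Ioo hδ.ne] at this
  exact this ⟨le_rfl, hδ.le⟩

lemma deriv_zero_on (g : ℝ → ℂ) (c : ℂ) (s : Set ℝ) (hs : IsOpen s) (h : ∀ r ∈ s, g r = c) :
    ∀ r ∈ s, deriv g r = 0 := by
  intro r hr
  have : g =ᶠ[nhds r] fun _ => c := by
    filter_upwards [hs.mem_nhds hr] with x hx using h x hx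
  rw [this.deriv_eq]; simp

lemma smooth_deriv (g : ℝ → ℂ) (hg : ContDiff ℝ (⊤ : ℕ∞) g) :
    ContDiff ℝ (⊤ : ℕ∞) (deriv g) := by
  exact (contDiff_infty_iff_deriv.1 hg).2

lemma smooth_hasDeriv (g : ℝ → ℂ) (hg : ContDiff ℝ (⊤ : ℕ∞) g) (r : ℝ) :
    HasDerivAt g (deriv g r) r :=
  ((contDiff_infty_iff_deriv.1 hg).1 r).hasDerivAt

lemma oscJ_rapid (a δ b : ℝ) (ha : 0 < a) (hδ : 0 < δ) (hb : b < a) (N : ℕ) :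
    ∀ g : ℝ → ℂ, ContDiff ℝ (⊤ : ℕ∞) g → (∀ r ∈ Set.Ioo 0 δ, g r = 0) →
      (∀ r ∈ Set.Ioi b, g r = 0) → (oscJ a g) =O[atTop] fun K : ℝ => (K⁻¹) ^ N := by
  induction N with
  | zero => intro g hg _ _; simpa using oscJ_bounded a ha g hg.continuous
  | succ N ih =>
    intro g hg h1 h2
    have h0 := zero_at_zero g hg.continuous δ hδ h1
    have hd := ih (deriv g) (smooth_deriv g hg) (deriv_zero_on g 0 _ isOpen_Ioo h1)
      (deriv_zero_on g 0 _ isOpen_Ioi h2)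
    have hm := inv_isBigO.mul hd
    refine IsBigO.congr' hm ?_ (Eventually.of_forall fun K => (pow_succ' _ _).symm)
    filter_upwards [eventually_ne_atTop 0] with K hK
    rw [oscJ_parts a g (deriv g) (smooth_hasDeriv g hg) (smooth_deriv g hg).continuous
      (h2 a hb) K hK, h0, zero_add]

lemma inv_mul_isBigO (N : ℕ) (f : ℝ → ℂ) (hf : f =O[atTop] fun K : ℝ => (K⁻¹) ^ N) :
    (fun K : ℝ => -(1 / (Complex.I * (K:ℂ))) * f K) =O[atTop] fun K : ℝ => (K⁻¹) ^ N := by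
  have h1 : (fun K : ℝ => K⁻¹) =O[atTop] fun _ : ℝ => (1:ℝ) :=
    tendsto_inv_atTop_zero.isBigO_one ℝ
  simpa using (inv_isBigO.trans h1).mul hf

lemma main_bigO (a δ b : ℝ) (ha : 0 < a) (hδ : 0 < δ) (hb : b < a) (F : ℝ → ℂ)
    (hF : ContDiff ℝ (⊤ : ℕ∞) F) (h1 : ∀ r ∈ Set.Ioo 0 δ, F r = 1)
    (h2 : ∀ r ∈ Set.Ioi b, F r = 0) (h0 : F 0 = 1) (N m : ℕ) :
    (fun K : ℝ => oscJ a (fun r => F r * (r:ℂ) ^ m) K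
      - (-1 : ℂ) ^ (m + 1) * (Nat.factorial m) / (Complex.I * K) ^ (m + 1))
      =O[atTop] fun K : ℝ => (K⁻¹) ^ N := by
  have hof : ContDiff ℝ (⊤ : ℕ∞) (fun r : ℝ => (r:ℂ)) := Complex.ofRealCLM.contDiff
  have hF' := smooth_deriv F hF
  have hz1 := deriv_zero_on F 1 _ isOpen_Ioo h1
  have hz2 := deriv_zero_on F 0 _ isOpen_Ioi h2
  have hJ : ∀ k : ℕ, (oscJ a fun r => deriv F r * (r:ℂ) ^ k) =O[atTop] fun K : ℝ => (K⁻¹) ^ N :=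
    fun k => oscJ_rapid a δ b ha hδ hb N _ (hF'.mul (hof.pow k))
      (fun r hr => by simp [hz1 r hr]) (fun r hr => by simp [hz2 r hr])
  induction m with
  | zero =>
    refine IsBigO.congr' (inv_mul_isBigO N _ (hJ 0)) ?_ EventuallyEq.rfl
    filter_upwards [eventually_ne_atTop 0] with K hK
    simp only [pow_zero, mul_one]
    rw [oscJ_parts a F (deriv F) (smooth_hasDeriv F hF) hF'.continuous (h2 a hb) K hK, h0]
    simp only [zero_add, pow_one, Nat.factorial_zero, Nat.cast_one, mul_one]
    ring
  | succ m ih =>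
    refine IsBigO.congr' (inv_mul_isBigO N _ ((ih.const_mul_left ((m:ℂ)+1)).add (hJ (m+1))))
      ?_ EventuallyEq.rfl
    filter_upwards [eventually_ne_atTop 0] with K hK
    have hc : Complex.I * (K:ℂ) ≠ 0 := by simp [hK]
    rw [oscJ_parts a (fun r => F r * (r:ℂ) ^ (m+1))
      (fun r => ((m:ℂ)+1) * (F r * (r:ℂ) ^ m) + deriv F r * (r:ℂ) ^ (m+1)) ?_ ?_ ?_ K hK,
      oscJ_add_const_mul]
    · rw [Nat.factorial_succ]
      generalize Complex.I * (K:ℂ) = c at *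
      push_cast
      simp only [Complex.ofReal_zero, zero_pow (Nat.succ_ne_zero m), mul_zero, zero_add]
      field_simp
      ring
    · exact hF.continuous.mul (hof.continuous.pow m)
    · exact hF'.continuous.mul (hof.continuous.pow _)
    · intro r
      have hr : HasDerivAt (fun r : ℝ => (r:ℂ)) 1 r := Complex.ofRealCLM.hasDerivAt (x := r)
      refine ((smooth_hasDeriv F hF r).mul (hr.pow (m+1))).congr_deriv ?_
      simp only [Pi.pow_apply, Nat.add_sub_cancel, mul_one]
      push_cast
      ring
    · exact (continuous_const.mul (hF.continuous.mul (hof.continuous.pow m))).add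
        (hF'.continuous.mul (hof.continuous.pow _))
    · simp [h2 a hb]

theorem stmt2 (a : ℝ) (ha : 0 < a) (ω : ℝ → ℝ)
    (hω : ContDiff ℝ (⊤ : ℕ∞) ω)
    (hcut : ∃ δ b : ℝ, 0 < δ ∧ δ < b ∧ b < a ∧
      (∀ r ∈ Set.Icc (0:ℝ) δ, ω r = 1) ∧ ∀ r : ℝ, b ≤ r → ω r = 0)
    (m : ℕ) (n : ℕ) (hn : 1 ≤ n) :
    (fun K : ℝ => (∫ r in (0:ℝ)..a, ((ω r * r ^ m : ℝ) : ℂ) * Complex.exp (Complex.I * K * r))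
        - (-1 : ℂ) ^ (m + 1) * (Nat.factorial m) / (Complex.I * K) ^ (m + 1))
      =o[atTop] fun K : ℝ => K ^ (-(n : ℤ)) := by
  obtain ⟨δ, b, hδ, hδb, hb, h1, h2⟩ := hcut
  have hO := main_bigO a δ b ha hδ hb (fun r => (ω r : ℂ)) (Complex.ofRealCLM.contDiff.comp hω)
    (fun r hr => by simp [h1 r ⟨hr.1.le, hr.2.le⟩])
    (fun r hr => by simp [h2 r (le_of_lt hr)]) (by simp [h1 0 ⟨le_rfl, hδ.le⟩]) (n+1) m
  have hlt : (fun K : ℝ => (K⁻¹) ^ (n+1)) =o[atTop] fun K : ℝ => K ^ (-(n : ℤ)) := by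
    have h3 : (fun K : ℝ => K⁻¹) =o[atTop] fun _ : ℝ => (1:ℝ) :=
      (isLittleO_one_iff ℝ).2 tendsto_inv_atTop_zero
    have h4 := h3.mul_isBigO (isBigO_refl (fun K : ℝ => (K⁻¹) ^ n) atTop)
    refine h4.congr (fun K => (pow_succ' _ _).symm) (fun K => ?_)
    simp
  refine (hO.trans_isLittleO hlt).congr_left fun K => ?_
  simp [oscJ]
end

section
/- Let a > 0 and let ω be a smooth cutoff function supported in [0, a). For all integers j ≥ 0 and ℓ ≥ 0, and for every positive integer n, one has ∫_0^a ω(r) r^(j+2) j_{ℓ+1}(K r) dr = ((j+ℓ+2)/K) · ∫_0^a ω(r) r^(j+1) j_ℓ(K r) dr + o(K^(−n)) as K → +∞. -/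
open MeasureTheory Filter Asymptotics

/-- The spherical Bessel functions of the first kind, defined recursively by
`j₀ x = sin x / x` and `j_{ℓ+1} x = - j_ℓ' x + ℓ * j_ℓ x / x`. -/
noncomputable def sphBessel : ℕ → ℝ → ℝ
  | 0 => fun x => Real.sin x / x
  | (ℓ + 1) => fun x => -(deriv (sphBessel ℓ) x) + (ℓ : ℝ) * sphBessel ℓ x / x

lemma analytic_dslope_zero (f : ℝ → ℝ) (hf : ∀ x, AnalyticAt ℝ f x) (x : ℝ) :
    AnalyticAt ℝ (dslope f 0) x := by
  by_cases hx : x = 0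
  · subst hx
    obtain ⟨p, hp⟩ := hf 0
    exact ⟨_, hp.has_fpower_series_dslope_fslope⟩
  · have h : AnalyticAt ℝ (fun y => (y - 0)⁻¹ * (f y - f 0)) x :=
      ((analyticAt_id.sub analyticAt_const).inv (by simpa using hx)).mul
        ((hf x).sub analyticAt_const)
    refine h.congr ?_
    filter_upwards [dslope_eventuallyEq_slope_of_ne f hx] with y hy
    rw [hy, slope_def_field]
    ring

lemma bessel_factor (ℓ : ℕ) : ∃ G : ℝ → ℝ, (∀ x, AnalyticAt ℝ G x) ∧ (∀ x, G (-x) = G x) ∧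
    ∀ x, x ≠ 0 → sphBessel ℓ x = x ^ ℓ * G x := by
  induction ℓ with
  | zero =>
    refine ⟨dslope Real.sin 0, analytic_dslope_zero _ (fun x => Real.analyticAt_sin), ?_, ?_⟩
    · intro x
      by_cases hx : x = 0
      · simp [hx]
      · rw [dslope_of_ne _ hx, dslope_of_ne _ (neg_ne_zero.mpr hx), slope_def_field,
          slope_def_field]
        simp
    · intro x hx
      rw [dslope_of_ne _ hx, slope_def_field]
      simp [sphBessel]
  | succ ℓ ih =>
    obtain ⟨G, hG, heven, hB⟩ := ih
    have hodd : ∀ x, deriv G (-x) = - deriv G x := by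
      intro x
      have h1 : (fun y => G (-y)) = G := funext heven
      have h2 := deriv_comp_neg (f := G) (x := x)
      rw [h1] at h2
      linarith
    have h0 : deriv G 0 = 0 := by
      have := hodd 0
      rw [neg_zero] at this
      linarith
    refine ⟨fun x => - dslope (deriv G) 0 x,
      fun x => (analytic_dslope_zero _ (fun x => (hG x).deriv) x).neg, ?_, ?_⟩
    · intro x
      by_cases hx : x = 0
      · simp [hx]
      · simp only []
        rw [dslope_of_ne _ hx, dslope_of_ne _ (neg_ne_zero.mpr hx), slope_def_field,
          slope_def_field, hodd, h0]
        simp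
    · intro x hx
      have hd : deriv (sphBessel ℓ) x = (ℓ : ℝ) * x ^ (ℓ - 1) * G x + x ^ ℓ * deriv G x := by
        have : sphBessel ℓ =ᶠ[nhds x] fun y => y ^ ℓ * G y := by
          filter_upwards [isOpen_ne.mem_nhds hx] with y hy using hB y hy
        rw [this.deriv_eq]
        exact ((hasDerivAt_pow ℓ x).mul (hG x).differentiableAt.hasDerivAt).deriv
      simp only [sphBessel]
      rw [hd, hB x hx, dslope_of_ne _ hx, slope_def_field, h0]
      rcases ℓ with _ | m
      · simp; field_simp
      · simp only [Nat.add_sub_cancel]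
        field_simp
        ring

lemma bessel_smooth : ∃ B : ℕ → ℝ → ℝ, (∀ ℓ, ContDiff ℝ (⊤ : ℕ∞) (B ℓ)) ∧
    (∀ ℓ x, x ≠ 0 → sphBessel ℓ x = B ℓ x) ∧ (∀ x, x ≠ 0 → x * B 0 x = Real.sin x) ∧
    ∀ ℓ x, x ≠ 0 → x * B (ℓ + 1) x = - (x * deriv (B ℓ) x) + ℓ * B ℓ x := by
  choose G hG _ hB using bessel_factor
  refine ⟨fun ℓ x => x ^ ℓ * G ℓ x, ?_, hB, ?_, ?_⟩
  · intro ℓ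
    have : ContDiff ℝ (⊤ : ℕ∞) (G ℓ) :=
      contDiff_iff_contDiffAt.mpr fun x => (hG ℓ x).contDiffAt
    fun_prop
  · intro x hx
    have := hB 0 x hx
    simp only [sphBessel] at this
    change x * (x ^ 0 * G 0 x) = Real.sin x
    rw [← this]
    field_simp
  · intro ℓ x hx
    have h : sphBessel ℓ =ᶠ[nhds x] fun y => y ^ ℓ * G ℓ y := by
      filter_upwards [isOpen_ne.mem_nhds hx] with y hy using hB ℓ y hy
    simp only []
    rw [← hB _ x hx, ← h.deriv_eq, ← hB _ x hx]
    simp only [sphBessel]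
    field_simp

/-- integration by parts -/
lemma ibp (a K : ℝ) (ψ F : ℝ → ℝ) (hψ : ContDiff ℝ (⊤ : ℕ∞) ψ) (hF : ContDiff ℝ (⊤ : ℕ∞) F)
    (h0 : ψ 0 = 0) (h1 : ψ a = 0) :
    ∫ r in (0:ℝ)..a, ψ r * (K * deriv F (K * r)) = - ∫ r in (0:ℝ)..a, deriv ψ r * F (K * r) := by
  have dψ := (contDiff_infty_iff_deriv.mp hψ)
  have dF := (contDiff_infty_iff_deriv.mp hF)
  have c1 := dψ.2.continuous
  have c2 := dF.2.continuous
  rw [intervalIntegral.integral_mul_deriv_eq_deriv_mul (u := ψ) (u' := deriv ψ)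
    (v := fun r => F (K * r)) (v' := fun r => K * deriv F (K * r))
    (fun x _ => (dψ.1 x).hasDerivAt) ?_ (c1.intervalIntegrable _ _) ?_]
  · simp [h0, h1]
  · intro x _
    have h := (dF.1 (K * x)).hasDerivAt.comp x ((hasDerivAt_id x).const_mul K)
    rw [mul_one, mul_comm] at h
    exact h
  · exact Continuous.intervalIntegrable (by fun_prop) _ _

/-- test functions -/
def TestFn (ε b : ℝ) (φ : ℝ → ℝ) : Prop :=
  ContDiff ℝ (⊤ : ℕ∞) φ ∧ (∀ r < ε, φ r = 0) ∧ ∀ r > b, φ r = 0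

lemma TestFn.deriv {ε b : ℝ} {φ : ℝ → ℝ} (h : TestFn ε b φ) : TestFn ε b (deriv φ) := by
  refine ⟨(contDiff_infty_iff_deriv.mp h.1).2, ?_, ?_⟩
  · intro r hr
    have : φ =ᶠ[nhds r] fun _ => 0 := by
      filter_upwards [isOpen_Iio.mem_nhds hr] with y hy using h.2.1 y hy
    rw [this.deriv_eq]; simp
  · intro r hr
    have : φ =ᶠ[nhds r] fun _ => 0 := by
      filter_upwards [isOpen_Ioi.mem_nhds hr] with y hy using h.2.2 y hy
    rw [this.deriv_eq]; simp

lemma TestFn.div {ε b : ℝ} (hε : 0 < ε) {φ : ℝ → ℝ} (h : TestFn ε b φ) :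
    TestFn ε b (fun r => φ r / r) := by
  refine ⟨contDiff_iff_contDiffAt.mpr fun x => ?_, fun r hr => by simp [h.2.1 r hr],
    fun r hr => by simp [h.2.2 r hr]⟩
  by_cases hx : x = 0
  · have : (fun r => φ r / r) =ᶠ[nhds x] fun _ => 0 := by
      filter_upwards [isOpen_Iio.mem_nhds (show x < ε by simpa [hx] using hε)] with y hy
      simp [h.2.1 y hy]
    exact contDiffAt_const.congr_of_eventuallyEq this
  · exact h.1.contDiffAt.div contDiffAt_id hx

lemma zpow_step (n : ℕ) (f g : ℝ → ℝ) (hfg : f =ᶠ[atTop] fun K => K⁻¹ * g K)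
    (hg : g =O[atTop] fun K : ℝ => K ^ (-(n : ℤ))) :
    f =O[atTop] fun K : ℝ => K ^ (-((n + 1 : ℕ) : ℤ)) := by
  have h1 : (fun K : ℝ => K⁻¹ * g K) =O[atTop] fun K : ℝ => K⁻¹ * K ^ (-(n : ℤ)) :=
    (isBigO_refl _ _).mul hg
  refine (hfg.trans_isBigO h1).congr' EventuallyEq.rfl ?_
  filter_upwards [eventually_gt_atTop 0] with K hK
  rw [← zpow_neg_one, ← zpow_add₀ hK.ne']
  congr 1
  push_cast
  ring

lemma zpow_succ_isLittleO (n : ℕ) :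
    (fun K : ℝ => K ^ (-((n + 1 : ℕ) : ℤ))) =o[atTop] fun K : ℝ => K ^ (-(n : ℤ)) := by
  have h1 : (fun K : ℝ => K⁻¹) =o[atTop] fun _ => (1:ℝ) :=
    (isLittleO_one_iff ℝ).mpr tendsto_inv_atTop_zero
  have h2 := h1.mul_isBigO (isBigO_refl (fun K : ℝ => K ^ (-(n : ℤ))) atTop)
  refine h2.congr' ?_ (by simp)
  filter_upwards [eventually_gt_atTop 0] with K hK
  rw [← zpow_neg_one, ← zpow_add₀ hK.ne']
  congr 1
  push_cast
  ring

lemma trig_decay (a ε b : ℝ) (ha : 0 < a) (hε : 0 < ε) (hb : b < a) (n : ℕ) :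
    ∀ φ, TestFn ε b φ →
      ((fun K : ℝ => ∫ r in (0:ℝ)..a, φ r * Real.sin (K * r)) =O[atTop]
        fun K : ℝ => K ^ (-(n : ℤ))) ∧
      ((fun K : ℝ => ∫ r in (0:ℝ)..a, φ r * Real.cos (K * r)) =O[atTop]
        fun K : ℝ => K ^ (-(n : ℤ))) := by
  induction n with
  | zero =>
    intro φ hφ
    have hc := hφ.1.continuous
    have key : ∀ t : ℝ → ℝ, (∀ x, |t x| ≤ 1) →
        (fun K : ℝ => ∫ r in (0:ℝ)..a, φ r * t (K * r)) =O[atTop]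
        fun K : ℝ => K ^ (-((0 : ℕ) : ℤ)) := by
      intro t ht
      refine IsBigO.of_bound (∫ r in (0:ℝ)..a, |φ r|) (Eventually.of_forall fun K => ?_)
      simp only [Nat.cast_zero, neg_zero, zpow_zero, norm_one, mul_one]
      refine intervalIntegral.norm_integral_le_of_norm_le ha.le (ae_of_all _ fun r _ => ?_)
        (hc.abs.intervalIntegrable _ _)
      rw [norm_mul]
      exact mul_le_of_le_one_right (abs_nonneg _) (ht _)
    exact ⟨key _ Real.abs_sin_le_one, key _ Real.abs_cos_le_one⟩
  | succ n ih =>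
    intro φ hφ
    have h0 := hφ.2.1 0 hε
    have h1 := hφ.2.2 a hb
    obtain ⟨hs, hc⟩ := ih _ hφ.deriv
    constructor
    · refine zpow_step n _ _ ?_ hc
      filter_upwards [eventually_gt_atTop 0] with K hK
      have := ibp a K φ Real.cos hφ.1 Real.contDiff_cos h0 h1
      rw [← neg_inj, neg_neg] at this
      rw [← this, ← intervalIntegral.integral_neg, ← intervalIntegral.integral_const_mul]
      congr 1; ext r
      rw [Real.deriv_cos]
      field_simp
    · refine zpow_step n _ _ ?_ hs.neg_left
      filter_upwards [eventually_gt_atTop 0] with K hK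
      have := ibp a K φ Real.sin hφ.1 Real.contDiff_sin h0 h1
      rw [← this, ← intervalIntegral.integral_const_mul]
      congr 1; ext r
      rw [Real.deriv_sin]
      field_simp

lemma recur (a : ℝ) (ha : 0 < a) (χ ψ B B' : ℝ → ℝ) (ℓ : ℕ)
    (hχ : ContDiff ℝ (⊤ : ℕ∞) χ) (hψ : ContDiff ℝ (⊤ : ℕ∞) ψ) (hψχ : ∀ r, ψ r = r * χ r)
    (hB : ContDiff ℝ (⊤ : ℕ∞) B)
    (hrel : ∀ x, x ≠ 0 → x * B' x = - (x * deriv B x) + ℓ * B x)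
    (h1 : χ a = 0) (K : ℝ) (hK : 0 < K) :
    ∫ r in (0:ℝ)..a, ψ r * B' (K * r) =
      K⁻¹ * ((∫ r in (0:ℝ)..a, deriv ψ r * B (K * r)) +
        ℓ * ∫ r in (0:ℝ)..a, χ r * B (K * r)) := by
  have e := ibp a K ψ B hψ hB (by simp [hψχ]) (by simp [hψχ, h1])
  rw [← neg_inj, neg_neg] at e
  have cB := hB.continuous
  have cB' := (contDiff_infty_iff_deriv.mp hB).2.continuous
  have cχ := hχ.continuous
  have cψ := hψ.continuous
  rw [← e, ← intervalIntegral.integral_neg, ← intervalIntegral.integral_const_mul,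
    ← intervalIntegral.integral_add
      (Continuous.intervalIntegrable (by fun_prop) _ _)
      (Continuous.intervalIntegrable (by fun_prop) _ _),
    ← intervalIntegral.integral_const_mul]
  refine intervalIntegral.integral_congr_ae (ae_of_all _ fun r hr => ?_)
  rw [Set.uIoc_of_le ha.le] at hr
  have hr0 : 0 < r := hr.1
  have := hrel (K * r) (by positivity)
  have h2 : ψ r * B' (K * r) = K⁻¹ * (χ r * (K * r * B' (K * r))) := by
    rw [hψχ]; field_simp
  rw [h2, this, hψχ]
  ring

lemma bessel_decay (a ε b : ℝ) (ha : 0 < a) (hε : 0 < ε) (hb : b < a)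
    (B : ℕ → ℝ → ℝ) (hB : ∀ ℓ, ContDiff ℝ (⊤ : ℕ∞) (B ℓ))
    (hB0 : ∀ x, x ≠ 0 → x * B 0 x = Real.sin x)
    (hrel : ∀ ℓ : ℕ, ∀ x, x ≠ 0 → x * B (ℓ + 1) x = - (x * deriv (B ℓ) x) + ℓ * B ℓ x)
    (ℓ : ℕ) : ∀ φ, TestFn ε b φ → ∀ n : ℕ,
      (fun K : ℝ => ∫ r in (0:ℝ)..a, φ r * B ℓ (K * r)) =O[atTop]
        fun K : ℝ => K ^ (-(n : ℤ)) := by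
  induction ℓ with
  | zero =>
    intro φ hφ n
    refine (zpow_step n _ _ ?_ (trig_decay a ε b ha hε hb n _ (hφ.div hε)).1).trans
      (zpow_succ_isLittleO n).isBigO
    filter_upwards [eventually_gt_atTop 0] with K hK
    rw [← intervalIntegral.integral_const_mul]
    refine intervalIntegral.integral_congr_ae (ae_of_all _ fun r hr => ?_)
    rw [Set.uIoc_of_le ha.le] at hr
    have hr0 : 0 < r := hr.1
    rw [← hB0 (K * r) (by positivity)]
    field_simp
  | succ ℓ ih =>
    intro φ hφ n
    refine (zpow_step n _ _ ?_ ((ih _ hφ.deriv n).add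
      ((ih _ (hφ.div hε) n).const_mul_left (ℓ : ℝ)))).trans (zpow_succ_isLittleO n).isBigO
    filter_upwards [eventually_gt_atTop 0] with K hK
    refine recur a ha _ φ (B ℓ) (B (ℓ + 1)) ℓ (hφ.div hε).1 hφ.1 ?_ (hB ℓ) (hrel ℓ)
      ((hφ.div hε).2.2 a hb) K hK
    intro r
    by_cases hr : r = 0
    · simp [hr, hφ.2.1 0 hε]
    · field_simp

theorem stmt3 (a : ℝ) (ha : 0 < a) (ω : ℝ → ℝ)
    (hω : ContDiff ℝ (⊤ : ℕ∞) ω)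
    (hcut : ∃ δ b : ℝ, 0 < δ ∧ δ < b ∧ b < a ∧
      (∀ r ∈ Set.Icc (0:ℝ) δ, ω r = 1) ∧ ∀ r : ℝ, b ≤ r → ω r = 0)
    (j ℓ : ℕ) (n : ℕ) (hn : 1 ≤ n) :
    (fun K : ℝ => (∫ r in (0:ℝ)..a, ω r * r ^ (j + 2) * sphBessel (ℓ + 1) (K * r))
        - ((j : ℝ) + (ℓ : ℝ) + 2) / K *
            ∫ r in (0:ℝ)..a, ω r * r ^ (j + 1) * sphBessel ℓ (K * r))
      =o[atTop] fun K : ℝ => K ^ (-(n : ℤ)) := by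
  obtain ⟨δ, b, hδ, hδb, hba, hone, hzero⟩ := hcut
  obtain ⟨B, hB, heq, hB0, hrel⟩ := bessel_smooth
  have dω := contDiff_infty_iff_deriv.mp hω
  set φ : ℝ → ℝ := fun r => Real.smoothTransition (4 / δ * r - 1) * (deriv ω r * r ^ (j + 2))
    with hφdef
  have hφ : TestFn (δ / 4) b φ := by
    refine ⟨?_, ?_, ?_⟩
    · have h1 : ContDiff ℝ (⊤ : ℕ∞) Real.smoothTransition := Real.smoothTransition.contDiff
      have h2 := dω.2
      exact (h1.comp (by fun_prop)).mul (h2.mul (by fun_prop))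
    · intro r hr
      have : 4 / δ * r - 1 ≤ 0 := by
        have : 4 / δ * r ≤ 4 / δ * (δ / 4) := by gcongr
        have h3 : 4 / δ * (δ / 4) = 1 := by field_simp
        linarith
      simp [hφdef, Real.smoothTransition.zero_of_nonpos this]
    · intro r hr
      have : ω =ᶠ[nhds r] fun _ => 0 := by
        filter_upwards [isOpen_Ioi.mem_nhds hr] with y hy using hzero y (le_of_lt hy)
      simp [hφdef, this.deriv_eq]
  have hφeq : ∀ r, 0 < r → φ r = deriv ω r * r ^ (j + 2) := by
    intro r hr
    by_cases h : r < δ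
    · have : ω =ᶠ[nhds r] fun _ => 1 := by
        filter_upwards [isOpen_Ioo.mem_nhds (show r ∈ Set.Ioo 0 δ from ⟨hr, h⟩)] with y hy
          using hone y ⟨hy.1.le, hy.2.le⟩
      simp [hφdef, this.deriv_eq]
    · have : 1 ≤ 4 / δ * r - 1 := by
        have : 4 / δ * δ ≤ 4 / δ * r := by gcongr; linarith
        have h3 : 4 / δ * δ = 4 := by field_simp
        linarith
      simp [hφdef, Real.smoothTransition.one_of_one_le this]
  have hdec := bessel_decay a (δ / 4) b ha (by positivity) hba B hB hB0 hrel ℓ φ hφ n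
  refine IsBigO.trans_isLittleO (zpow_step n _ _ ?_ hdec) (zpow_succ_isLittleO n)
  filter_upwards [eventually_gt_atTop 0] with K hK
  have hcongr : ∀ (m : ℕ) (f : ℝ → ℝ), ∫ r in (0:ℝ)..a, f r * sphBessel m (K * r) =
      ∫ r in (0:ℝ)..a, f r * B m (K * r) := by
    intro m f
    refine intervalIntegral.integral_congr_ae (ae_of_all _ fun r hr => ?_)
    rw [Set.uIoc_of_le ha.le] at hr
    have hr0 : 0 < r := hr.1
    rw [heq m (K * r) (by positivity)]
  rw [hcongr (ℓ + 1) (fun r => ω r * r ^ (j + 2)), hcongr ℓ (fun r => ω r * r ^ (j + 1))]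
  have hr := recur a ha (fun r => ω r * r ^ (j + 1)) (fun r => ω r * r ^ (j + 2)) (B ℓ)
    (B (ℓ + 1)) ℓ (by fun_prop) (by fun_prop) (fun r => by ring) (hB ℓ) (hrel ℓ)
    (by simp [hzero a hba.le]) K hK
  have cB := (hB ℓ).continuous
  have cφ := hφ.1.continuous
  have cω := hω.continuous
  have hsplit : ∫ r in (0:ℝ)..a, deriv (fun r => ω r * r ^ (j + 2)) r * B ℓ (K * r) =
      (∫ r in (0:ℝ)..a, φ r * B ℓ (K * r)) +
        ((j : ℝ) + 2) * ∫ r in (0:ℝ)..a, ω r * r ^ (j + 1) * B ℓ (K * r) := by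
    rw [← intervalIntegral.integral_const_mul, ← intervalIntegral.integral_add
      (Continuous.intervalIntegrable (by fun_prop) _ _)
      (Continuous.intervalIntegrable (by fun_prop) _ _)]
    refine intervalIntegral.integral_congr_ae (ae_of_all _ fun r hr => ?_)
    rw [Set.uIoc_of_le ha.le] at hr
    have hd : deriv (fun r => ω r * r ^ (j + 2)) r =
        deriv ω r * r ^ (j + 2) + ω r * (((j + 2 : ℕ) : ℝ) * r ^ (j + 1)) :=
      ((dω.1 r).hasDerivAt.mul (hasDerivAt_pow (j + 2) r)).deriv
    rw [hd, hφeq r hr.1]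
    push_cast
    ring
  rw [hr, hsplit]
  field_simp
  ring
end

section
/- Let a > 0 and let ω be a smooth cutoff function supported in [0, a). Let j ≥ 0 be an integer and define F : ℝ³ → ℂ by F(k) = ∫_{ℝ³} ω(‖x‖) ‖x‖^j exp(−i ⟨k, x⟩) dx, where ⟨·,·⟩ is the Euclidean inner product on ℝ³. If j is odd, then for every positive integer n, F(k) − 4π(−1)^((j+1)/2)(j+1)!/‖k‖^(j+3) is o(‖k‖^(−n)) as ‖k‖ → +∞. If j is even, then for every positive integer n, F(k) is o(‖k‖^(−n)) as ‖k‖ → +∞. -/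
open MeasureTheory Filter Asymptotics RealInnerProductSpace

lemma ibp_step (a b : ℝ) (f : ℝ → ℝ) (hf : ContDiff ℝ (⊤ : ℕ∞) f) (hba : b < a)
    (hz : ∀ r : ℝ, b ≤ r → f r = 0) (κ : ℝ) (hκ : κ ≠ 0) (m : ℕ) :
    (∫ t in (0:ℝ)..a, ((iteratedDeriv m f t : ℝ) : ℂ) * Complex.exp (Complex.I * κ * t))
     = (Complex.I / κ) * ((iteratedDeriv m f 0 : ℝ) : ℂ) + (Complex.I / κ) *
      ∫ t in (0:ℝ)..a, ((iteratedDeriv (m+1) f t : ℝ) : ℂ) * Complex.exp (Complex.I * κ * t) := by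
  have hκ' : (κ : ℂ) ≠ 0 := by exact_mod_cast hκ
  have hI : Complex.I * κ ≠ 0 := mul_ne_zero Complex.I_ne_zero hκ'
  have hd : ∀ t, HasDerivAt (fun t => ((iteratedDeriv m f t : ℝ) : ℂ))
      ((iteratedDeriv (m+1) f t : ℝ) : ℂ) t := by
    intro t
    have h1 : Differentiable ℝ (iteratedDeriv m f) :=
      hf.differentiable_iteratedDeriv m (by exact_mod_cast ENat.natCast_lt_top m)
    have := (h1 t).hasDerivAt
    rw [iteratedDeriv_succ]
    exact this.ofReal_comp
  have he : ∀ t : ℝ, HasDerivAt (fun t : ℝ => Complex.exp (Complex.I * κ * t) / (Complex.I * κ))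
      (Complex.exp (Complex.I * κ * t)) t := by
    intro t
    have h0 : HasDerivAt (fun t : ℝ => Complex.I * κ * (t:ℂ)) (Complex.I * κ * 1) t := by
      have := (Complex.ofRealCLM.hasDerivAt (x := t)).const_mul (Complex.I * κ)
      simpa using this
    have := h0.cexp.div_const (Complex.I * κ)
    refine this.congr_deriv ?_
    rw [mul_one, mul_div_assoc, div_self hI, mul_one]
  have hc : ∀ m, Continuous (iteratedDeriv m f) := fun m =>
    hf.continuous_iteratedDeriv m (by exact_mod_cast le_top)
  have h := intervalIntegral.integral_mul_deriv_eq_deriv_mul (a := 0) (b := a)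
    (fun t _ => hd t) (fun t _ => he t)
    ((Complex.continuous_ofReal.comp (hc (m+1))).intervalIntegrable _ _)
    (Continuous.intervalIntegrable (by fun_prop) _ _)
  have hza : iteratedDeriv m f a = 0 := by
    have : f =ᶠ[nhds a] fun _ => 0 := by
      filter_upwards [lt_mem_nhds hba] with t ht using hz t ht.le
    rw [this.iteratedDeriv_eq]
    simp
  rw [h, hza]
  have : ∀ t : ℝ, ((iteratedDeriv (m+1) f t : ℝ) : ℂ) * (Complex.exp (Complex.I * κ * t) / (Complex.I * κ))
    = (Complex.I * κ)⁻¹ * (((iteratedDeriv (m+1) f t : ℝ) : ℂ) * Complex.exp (Complex.I * κ * t)) := by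
    intro t; ring
  simp_rw [this]
  rw [intervalIntegral.integral_const_mul]
  have hinv : (Complex.I * (κ:ℂ))⁻¹ = - (Complex.I / κ) := by
    rw [mul_inv, Complex.inv_I]; ring
  simp only [div_eq_mul_inv _ (Complex.I * (κ:ℂ)), hinv]
  simp
  ring

lemma ibp_sum (a b : ℝ) (f : ℝ → ℝ) (hf : ContDiff ℝ (⊤ : ℕ∞) f) (hba : b < a)
    (hz : ∀ r : ℝ, b ≤ r → f r = 0) (κ : ℝ) (hκ : κ ≠ 0) (N : ℕ) :
    (∫ t in (0:ℝ)..a, ((f t : ℝ) : ℂ) * Complex.exp (Complex.I * κ * t))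
     = (∑ m ∈ Finset.range N, (Complex.I / κ) ^ (m+1) * ((iteratedDeriv m f 0 : ℝ) : ℂ)) +
      (Complex.I / κ) ^ N *
      ∫ t in (0:ℝ)..a, ((iteratedDeriv N f t : ℝ) : ℂ) * Complex.exp (Complex.I * κ * t) := by
  induction N with
  | zero => simp
  | succ N ih =>
    rw [ih, ibp_step a b f hf hba hz κ hκ N, Finset.sum_range_succ]
    ring

lemma inner_plane (b : ℝ) (g G : ℝ → ℝ) (hg : Continuous g) (hgz : ∀ r, b ≤ r → g r = 0)
    (hG : ∀ t, HasDerivAt G (-(g t * t)) t) (hGz : ∀ r, b ≤ r → G r = 0) (t : ℝ) :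
    ∫ y : EuclideanSpace ℝ (Fin 2), g (Real.sqrt (t ^ 2 + ‖y‖ ^ 2)) = 2 * Real.pi * G |t| := by
  rw [integral_fun_norm_addHaar volume (fun s => g (Real.sqrt (t ^ 2 + s ^ 2)))]
  have hvol : (volume : Measure (EuclideanSpace ℝ (Fin 2))).real (Metric.ball 0 1) = Real.pi := by
    rw [Measure.real, InnerProductSpace.volume_ball_of_dim_even (k := 1) (by simp)]
    simp [Real.pi_nonneg]
  have hint : ∫ s in Set.Ioi (0:ℝ), s * g (Real.sqrt (t ^ 2 + s ^ 2)) = G |t| := by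
    have hbd : ∀ s, max b 0 ≤ s → b ≤ Real.sqrt (t ^ 2 + s ^ 2) := by
      intro s hs
      have h0 : 0 ≤ s := (le_max_right _ _).trans hs
      refine ((le_max_left _ _).trans hs).trans ?_
      apply Real.le_sqrt_of_sq_le
      nlinarith [sq_nonneg t]
    have hcont : Continuous fun s : ℝ => s * g (Real.sqrt (t ^ 2 + s ^ 2)) := by fun_prop
    have hI : IntegrableOn (fun s : ℝ => s * g (Real.sqrt (t ^ 2 + s ^ 2))) (Set.Ioi 0) := by
      have h1 : IntegrableOn (fun s : ℝ => s * g (Real.sqrt (t ^ 2 + s ^ 2)))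
          (Set.Icc 0 (max b 0)) := hcont.continuousOn.integrableOn_Icc
      refine h1.of_forall_sdiff_eq_zero measurableSet_Ioi ?_
      intro s hs
      have : max b 0 ≤ s := by
        by_contra h
        exact hs.2 ⟨le_of_lt hs.1, le_of_not_ge h⟩
      simp [hgz _ (hbd s this)]
    have hGc : Continuous G := continuous_iff_continuousAt.2 fun t => (hG t).continuousAt
    have := integral_Ioi_of_hasDerivAt_of_tendsto (a := 0) (m := 0)
      (f := fun s => - G (Real.sqrt (t ^ 2 + s ^ 2)))
      (f' := fun s => s * g (Real.sqrt (t ^ 2 + s ^ 2))) ?_ ?_ hI ?_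
    · rw [this]; simp [Real.sqrt_sq_eq_abs]
    · exact Continuous.continuousWithinAt (by fun_prop)
    · intro s hs
      have hs : 0 < s := hs
      have hpos : 0 < t ^ 2 + s ^ 2 := by positivity
      have h1 : HasDerivAt (fun s : ℝ => t ^ 2 + s ^ 2) (2 * s) s := by
        simpa using (hasDerivAt_pow 2 s).const_add (t ^ 2)
      have h2 := h1.sqrt hpos.ne'
      have h3 := ((hG _).comp s h2).neg
      have h4 := (Real.sqrt_pos.2 hpos).ne'
      refine HasDerivAt.congr_deriv (f := fun s => - G (Real.sqrt (t ^ 2 + s ^ 2))) h3 ?_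
      field_simp
    · refine tendsto_const_nhds.congr' ?_
      filter_upwards [eventually_ge_atTop (max b 0)] with s hs
      simp [hGz _ (hbd s hs)]
  simp only [finrank_euclideanSpace, Fintype.card_fin, hvol]
  simp only [Nat.reduceSub, pow_one, smul_eq_mul, hint]
  simp; ring

lemma rotate_slice (b : ℝ) (g : ℝ → ℝ) (hg : Continuous g) (hgz : ∀ r, b ≤ r → g r = 0)
    (k : EuclideanSpace ℝ (Fin 3)) (hk : k ≠ 0) :
    ∫ x : EuclideanSpace ℝ (Fin 3), ((g ‖x‖ : ℝ) : ℂ) * Complex.exp (-Complex.I * (⟪k, x⟫ : ℝ))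
    = ∫ t : ℝ, ((∫ y : EuclideanSpace ℝ (Fin 2), g (Real.sqrt (t ^ 2 + ‖y‖ ^ 2)) : ℝ) : ℂ) *
        Complex.exp (-Complex.I * ((‖k‖ * t : ℝ) : ℂ)) := by
  have hk0 : ‖k‖ ≠ 0 := norm_ne_zero_iff.2 hk
  obtain ⟨B, hB⟩ := Orthonormal.exists_orthonormalBasis_extension_of_card_eq (𝕜 := ℝ)
    (E := EuclideanSpace ℝ (Fin 3)) (ι := Fin 3) (by simp)
    (v := fun _ => (‖k‖⁻¹ : ℝ) • k) (s := {0}) (by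
      refine ⟨fun i => ?_, fun i j hij => (hij (Subsingleton.elim _ _)).elim⟩
      simp [norm_smul, hk0])
  have hB0 := hB 0 rfl
  let e : EuclideanSpace ℝ (Fin 3) ≃ᵐ ℝ × (Fin 2 → ℝ) :=
    (B.repr.toMeasurableEquiv.trans (MeasurableEquiv.toLp 2 (Fin 3 → ℝ)).symm).trans
      (MeasurableEquiv.piFinSuccAbove (fun _ : Fin 3 => ℝ) 0)
  have he : MeasurePreserving e volume (volume.prod volume) :=
    (B.measurePreserving_repr.trans
      (EuclideanSpace.volume_preserving_symm_measurableEquiv_toLp (Fin 3))).trans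
      (volume_preserving_piFinSuccAbove (fun _ : Fin 3 => ℝ) 0)
  have e1 : ∀ x, (e x).1 = B.repr x 0 := fun x => rfl
  have e2 : ∀ x i, (e x).2 i = B.repr x (Fin.succ i) := fun x i => rfl
  have hnorm : ∀ x, ‖x‖ = Real.sqrt ((e x).1 ^ 2 + ‖WithLp.toLp 2 (e x).2‖ ^ 2) := by
    intro x
    rw [← B.repr.norm_map x, EuclideanSpace.norm_eq, EuclideanSpace.norm_sq_eq]
    congr 1
    rw [Fin.sum_univ_succ]
    simp only [e1, e2, Real.norm_eq_abs, sq_abs]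
  have hinner : ∀ x, (⟪k, x⟫ : ℝ) = ‖k‖ * (e x).1 := by
    intro x
    rw [e1, B.repr_apply_apply, hB0, inner_smul_left]
    simp [hk0]
  let H : ℝ × (Fin 2 → ℝ) → ℂ := fun p =>
    ((g (Real.sqrt (p.1 ^ 2 + ‖WithLp.toLp 2 p.2‖ ^ 2)) : ℝ) : ℂ) *
      Complex.exp (-Complex.I * ((‖k‖ * p.1 : ℝ) : ℂ))
  have hfH : ∀ x, ((g ‖x‖ : ℝ) : ℂ) * Complex.exp (-Complex.I * (⟪k, x⟫ : ℝ)) = H (e x) := by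
    intro x
    simp only [H]
    rw [← hnorm, ← hinner]
  have hint : Integrable (fun x : EuclideanSpace ℝ (Fin 3) =>
      ((g ‖x‖ : ℝ) : ℂ) * Complex.exp (-Complex.I * (⟪k, x⟫ : ℝ))) := by
    apply Continuous.integrable_of_hasCompactSupport
    · fun_prop
    · apply HasCompactSupport.of_support_subset_isCompact (isCompact_closedBall 0 b)
      intro x hx
      rw [mem_closedBall_zero_iff]
      by_contra h
      apply hx
      simp [hgz _ (le_of_not_ge h)]
  simp_rw [hfH] at hint ⊢
  have hH : Integrable H (volume.prod volume) :=
    (he.integrable_comp_emb e.measurableEmbedding).1 hint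
  rw [he.integral_comp' H, integral_prod _ hH]
  congr 1
  ext t
  simp only [H]
  rw [integral_mul_const, integral_complex_ofReal]
  congr 2
  exact (PiLp.volume_preserving_toLp (Fin 2)).integral_comp
    (MeasurableEquiv.toLp 2 (Fin 2 → ℝ)).measurableEmbedding
    (fun y : EuclideanSpace ℝ (Fin 2) => g (Real.sqrt (t ^ 2 + ‖y‖ ^ 2)))

lemma radial_formula (a b : ℝ) (ha : 0 < a) (hba : b < a) (g G : ℝ → ℝ) (hg : Continuous g)
    (hgz : ∀ r, b ≤ r → g r = 0)
    (hG : ∀ t, HasDerivAt G (-(g t * t)) t) (hGz : ∀ r, b ≤ r → G r = 0)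
    (k : EuclideanSpace ℝ (Fin 3)) (hk : k ≠ 0) :
    ∫ x : EuclideanSpace ℝ (Fin 3), ((g ‖x‖ : ℝ) : ℂ) * Complex.exp (-Complex.I * (⟪k, x⟫ : ℝ))
    = ((4 * Real.pi *
      (∫ t in (0:ℝ)..a, ((G t : ℝ) : ℂ) * Complex.exp (Complex.I * ‖k‖ * t)).re : ℝ) : ℂ) := by
  rw [rotate_slice b g hg hgz k hk]
  simp_rw [inner_plane b g G hg hgz hG hGz]
  have hGc : Continuous G := continuous_iff_continuousAt.2 fun t => (hG t).continuousAt
  set κ := ‖k‖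
  let h : ℝ → ℂ := fun t => ((G |t| : ℝ) : ℂ) * Complex.exp (-Complex.I * ((κ * t : ℝ) : ℂ))
  have hhc : Continuous h := by simp only [h]; fun_prop
  have hhi : Integrable h := by
    apply hhc.integrable_of_hasCompactSupport
    apply HasCompactSupport.of_support_subset_isCompact (isCompact_closedBall 0 b)
    intro x hx
    rw [mem_closedBall_zero_iff]
    by_contra hh
    apply hx
    have h0 : G |x| = 0 := hGz _ (le_of_not_ge hh)
    simp [h, h0]
  have h1 : ∀ t : ℝ, ((2 * Real.pi * G |t| : ℝ) : ℂ) *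
      Complex.exp (-Complex.I * ((κ * t : ℝ) : ℂ)) = (2 * Real.pi : ℂ) * h t := by
    intro t; simp only [h]; push_cast; ring
  simp_rw [h1]
  rw [integral_const_mul]
  set K := ∫ t in (0:ℝ)..a, ((G t : ℝ) : ℂ) * Complex.exp (Complex.I * κ * t) with hK
  have hKI : K = ∫ t in Set.Ioi (0:ℝ), h (-t) := by
    rw [hK, intervalIntegral.integral_of_le ha.le]
    have : ∫ t in Set.Ioi (0:ℝ), h (-t) = ∫ t in Set.Ioc (0:ℝ) a, h (-t) := by
      refine (setIntegral_eq_of_subset_of_forall_sdiff_eq_zero measurableSet_Ioi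
        Set.Ioc_subset_Ioi_self ?_)
      intro t ht
      have h2 : a < t := by
        by_contra h'
        exact ht.2 ⟨ht.1, le_of_not_gt h'⟩
      have h3 : G |t| = 0 := hGz _ ((hba.trans h2).le.trans (le_abs_self t))
      simp [h, h3]
    rw [this]
    refine setIntegral_congr_fun measurableSet_Ioc fun t ht => ?_
    simp only [h, abs_neg, abs_of_pos ht.1]
    congr 2
    push_cast; ring
  have hKc : (starRingEnd ℂ) K = ∫ t in Set.Ioi (0:ℝ), h t := by
    rw [hKI, ← integral_conj]
    refine setIntegral_congr_fun measurableSet_Ioi fun t ht => ?_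
    simp only [h, map_mul, ← Complex.exp_conj, abs_neg, Complex.conj_ofReal, map_neg,
      Complex.conj_I]
    congr 2
    push_cast; ring
  have hsum : ∫ t, h t = K + (starRingEnd ℂ) K := by
    rw [hKc, hKI, integral_comp_neg_Ioi, neg_zero]
    exact (intervalIntegral.integral_Iic_add_Ioi hhi.integrableOn hhi.integrableOn).symm
  rw [hsum, Complex.add_conj]
  push_cast; ring

lemma iteratedDeriv_zero_phi (δ : ℝ) (hδ : 0 < δ) (φ : ℝ → ℝ) (hφ : ContDiff ℝ (⊤ : ℕ∞) φ) (p : ℕ)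
    (h : ∀ t ∈ Set.Icc (0:ℝ) δ, φ t = t ^ p) (m : ℕ) :
    iteratedDeriv m φ 0 = if m = p then (p.factorial : ℝ) else 0 := by
  have hp : ContDiff ℝ (⊤ : ℕ∞) (fun t : ℝ => t ^ p) := by fun_prop
  have c1 := (hφ.continuous_iteratedDeriv m (by exact_mod_cast le_top)).tendsto 0
  have c2 := (hp.continuous_iteratedDeriv m (by exact_mod_cast le_top)).tendsto 0
  have heq : iteratedDeriv m φ =ᶠ[nhdsWithin 0 (Set.Ioi 0)] iteratedDeriv m (fun t : ℝ => t ^ p) := by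
    filter_upwards [Ioo_mem_nhdsGT hδ] with t ht
    have : φ =ᶠ[nhds t] fun t => t ^ p := by
      filter_upwards [Ioo_mem_nhds ht.1 ht.2] with s hs using h s ⟨hs.1.le, hs.2.le⟩
    exact this.iteratedDeriv_eq m
  have := tendsto_nhds_unique ((c1.mono_left nhdsWithin_le_nhds).congr' heq)
    (c2.mono_left nhdsWithin_le_nhds)
  rw [this, iteratedDeriv_eq_iterate, iter_deriv_pow]
  have hprod : ∏ i ∈ Finset.range m, ((p:ℝ) - i) = (p.descFactorial m : ℝ) := by
    rw [← descPochhammer_eval_eq_prod_range, descPochhammer_eval_eq_descFactorial]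
  split_ifs with hm
  · subst hm; simp [hprod, Nat.descFactorial_self]
  · rcases lt_or_gt_of_ne hm with h1 | h1
    · simp [Nat.sub_ne_zero_of_lt h1]
    · simp [hprod, Nat.descFactorial_of_lt h1]

lemma core_expansion (a : ℝ) (ha : 0 < a) (ω : ℝ → ℝ)
    (hω : ContDiff ℝ (⊤ : ℕ∞) ω)
    (hcut : ∃ δ b : ℝ, 0 < δ ∧ δ < b ∧ b < a ∧
      (∀ r ∈ Set.Icc (0:ℝ) δ, ω r = 1) ∧ ∀ r : ℝ, b ≤ r → ω r = 0)
    (j : ℕ) (n : ℕ) : ∃ C : ℝ, ∀ k : EuclideanSpace ℝ (Fin 3), k ≠ 0 →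
      ‖(∫ x : EuclideanSpace ℝ (Fin 3),
        ((ω ‖x‖ * ‖x‖ ^ j : ℝ) : ℂ) * Complex.exp (-Complex.I * (⟪k, x⟫ : ℝ))) -
        ((4 * Real.pi * (-(Complex.I ^ (j + 3))).re * (j+1).factorial : ℝ) : ℂ)
          / (‖k‖ : ℂ) ^ (j + 3)‖
        ≤ C * ‖k‖ ^ (-((n + j + 4 : ℕ) : ℤ)) := by
  obtain ⟨δ, b, hδ, hδb, hba, h1, hz⟩ := hcut
  let φ : ℝ → ℝ := fun s => ω s * s ^ (j+1)
  have hφ : ContDiff ℝ (⊤ : ℕ∞) φ := hω.mul (by fun_prop)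
  have hφz : ∀ r, b ≤ r → φ r = 0 := fun r hr => by simp [φ, hz r hr]
  let G : ℝ → ℝ := fun t => - ∫ s in a..t, φ s
  have hG' : ∀ t, HasDerivAt G (- φ t) t := fun t =>
    (intervalIntegral.integral_hasDerivAt_right (hφ.continuous.intervalIntegrable _ _)
      (hφ.continuous.stronglyMeasurableAtFilter _ _) hφ.continuous.continuousAt).neg
  have hdG : deriv G = fun t => - φ t := funext fun t => (hG' t).deriv
  have hGs : ContDiff ℝ (⊤ : ℕ∞) G := by
    rw [contDiff_infty_iff_deriv]
    exact ⟨fun t => (hG' t).differentiableAt, by rw [hdG]; exact hφ.neg⟩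
  have hG : ∀ t, HasDerivAt G (-((ω t * t ^ j) * t)) t := by
    intro t
    convert hG' t using 1
    simp only [φ]; ring
  have hGz : ∀ r, b ≤ r → G r = 0 := by
    intro r hr
    have : ∫ s in a..r, φ s = ∫ s in a..r, (0:ℝ) := by
      refine intervalIntegral.integral_congr fun s hs => hφz s ?_
      exact (le_min hba.le hr).trans hs.1
    simp [G, this]
  have hGd : ∀ m, iteratedDeriv (m+1) G 0 = if m = j+1 then -((j+1).factorial : ℝ) else 0 := by
    intro m
    rw [iteratedDeriv_succ', hdG, iteratedDeriv_fun_neg, iteratedDeriv_zero_phi δ hδ φ hφ (j+1)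
      (fun t ht => by simp [φ, h1 t ht])]
    split_ifs <;> simp
  set N := n + j + 4 with hN
  have hNc : Continuous (iteratedDeriv N G) :=
    hGs.continuous_iteratedDeriv N (by exact_mod_cast le_top)
  let C := ∫ t in (0:ℝ)..a, |iteratedDeriv N G t|
  refine ⟨4 * Real.pi * C, fun k hk => ?_⟩
  have hk0 : 0 < ‖k‖ := norm_pos_iff.2 hk
  rw [radial_formula a b ha hba (fun r => ω r * r ^ j) G
    (hω.continuous.mul (by fun_prop)) (fun r hr => by simp [hz r hr]) hG hGz k hk]
  rw [ibp_sum a b G hGs hba hGz ‖k‖ hk0.ne' N]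
  set κ := ‖k‖
  set J := ∫ t in (0:ℝ)..a, ((iteratedDeriv N G t : ℝ) : ℂ) * Complex.exp (Complex.I * κ * t)
    with hJ
  have hJC : ‖J‖ ≤ C := by
    refine (intervalIntegral.norm_integral_le_integral_norm ha.le).trans_eq ?_
    refine intervalIntegral.integral_congr fun t _ => ?_
    have : Complex.I * κ * t = ((κ * t : ℝ) : ℂ) * Complex.I := by push_cast; ring
    simp only [norm_mul, this, Complex.norm_exp_ofReal_mul_I]
    simp
  have hsum : (∑ m ∈ Finset.range N, (Complex.I / κ) ^ (m+1) * ((iteratedDeriv m G 0 : ℝ) : ℂ))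
      = (Complex.I / κ) * (G 0 : ℝ) + ((1 / κ ^ (j+3) * (j+1).factorial : ℝ) : ℂ) *
        (-(Complex.I ^ (j + 3))) := by
    rw [show N = (n + j + 3) + 1 from rfl, Finset.sum_range_succ']
    simp_rw [hGd]
    rw [Finset.sum_eq_single (j+1)]
    · simp only [if_true, iteratedDeriv_zero]
      push_cast
      rw [div_pow]
      ring
    · intro m _ hm
      simp [hm]
    · intro h
      exact (h (Finset.mem_range.2 (by omega))).elim
  have hre : ((Complex.I / κ) * (G 0 : ℝ)).re = 0 := by
    rw [show (Complex.I / κ) * ((G 0 : ℝ) : ℂ) = ((G 0 / κ : ℝ) : ℂ) * Complex.I by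
      push_cast; ring]
    simp
  rw [hsum, Complex.add_re, Complex.add_re, hre, Complex.re_ofReal_mul]
  have : ((4 * Real.pi * (0 + 1 / κ ^ (j+3) * (j+1).factorial * (-(Complex.I ^ (j + 3))).re
        + ((Complex.I / κ) ^ N * J).re) : ℝ) : ℂ)
      - ((4 * Real.pi * (-(Complex.I ^ (j + 3))).re * (j+1).factorial : ℝ) : ℂ)
          / (κ : ℂ) ^ (j + 3) = ((4 * Real.pi * ((Complex.I / κ) ^ N * J).re : ℝ) : ℂ) := by
    push_cast
    ring
  rw [this, Complex.norm_real, norm_mul, Real.norm_of_nonneg (show (0:ℝ) ≤ 4 * Real.pi by positivity),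
    mul_assoc (4 * Real.pi) C]
  refine mul_le_mul_of_nonneg_left ?_ (by positivity)
  refine (Complex.abs_re_le_norm _).trans ?_
  rw [norm_mul, norm_pow, norm_div, Complex.norm_I, Complex.norm_real,
    Real.norm_of_nonneg hk0.le, zpow_neg, zpow_natCast, div_pow, one_pow, one_div, mul_comm]
  gcongr

theorem stmt4 (a : ℝ) (ha : 0 < a) (ω : ℝ → ℝ)
    (hω : ContDiff ℝ (⊤ : ℕ∞) ω)
    (hcut : ∃ δ b : ℝ, 0 < δ ∧ δ < b ∧ b < a ∧
      (∀ r ∈ Set.Icc (0:ℝ) δ, ω r = 1) ∧ ∀ r : ℝ, b ≤ r → ω r = 0)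
    (j : ℕ) (n : ℕ) (hn : 1 ≤ n)
    (F : EuclideanSpace ℝ (Fin 3) → ℂ)
    (hF : ∀ k : EuclideanSpace ℝ (Fin 3),
      F k = ∫ x : EuclideanSpace ℝ (Fin 3),
        ((ω ‖x‖ * ‖x‖ ^ j : ℝ) : ℂ) * Complex.exp (-Complex.I * (⟪k, x⟫ : ℝ))) :
    (Odd j →
      (fun k : EuclideanSpace ℝ (Fin 3) =>
          F k - ((4 * Real.pi * (-1 : ℝ) ^ ((j + 1) / 2) * (Nat.factorial (j + 1)) : ℝ) : ℂ)
            / (‖k‖ : ℂ) ^ (j + 3))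
        =o[Filter.comap norm Filter.atTop] fun k => ‖k‖ ^ (-(n : ℤ))) ∧
    (Even j →
      F =o[Filter.comap norm Filter.atTop]
        fun k : EuclideanSpace ℝ (Fin 3) => ‖k‖ ^ (-(n : ℤ))) := by
  obtain ⟨C, hC⟩ := core_expansion a ha ω hω hcut j n
  simp_rw [← hF] at hC
  have hpos : ∀ᶠ k : EuclideanSpace ℝ (Fin 3) in Filter.comap norm Filter.atTop, 0 < ‖k‖ :=
    tendsto_comap.eventually (eventually_gt_atTop 0)
  have hO : (fun k : EuclideanSpace ℝ (Fin 3) => F k -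
        ((4 * Real.pi * (-(Complex.I ^ (j + 3))).re * (j+1).factorial : ℝ) : ℂ)
          / (‖k‖ : ℂ) ^ (j + 3)) =o[Filter.comap norm Filter.atTop] fun k => ‖k‖ ^ (-(n : ℤ)) := by
    have hB : (fun k : EuclideanSpace ℝ (Fin 3) => F k -
        ((4 * Real.pi * (-(Complex.I ^ (j + 3))).re * (j+1).factorial : ℝ) : ℂ)
          / (‖k‖ : ℂ) ^ (j + 3)) =O[Filter.comap norm Filter.atTop]
          fun k => ‖k‖ ^ (-((n + j + 4 : ℕ) : ℤ)) := by
      refine IsBigO.of_bound C ?_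
      filter_upwards [hpos] with k hk
      rw [Real.norm_of_nonneg (by positivity)]
      exact hC k (norm_pos_iff.1 hk)
    refine hB.trans_isLittleO ?_
    have h0 : (fun x : ℝ => x ^ (-((j + 4 : ℕ) : ℤ))) =o[atTop] fun _ => (1:ℝ) :=
      (isLittleO_one_iff ℝ).2 (tendsto_pow_neg_atTop (by omega))
    have h2 := ((isBigO_refl (fun x : ℝ => x ^ (-(n:ℤ))) atTop).mul_isLittleO h0).comp_tendsto
      (tendsto_comap (f := (norm : EuclideanSpace ℝ (Fin 3) → ℝ)))
    refine h2.congr' ?_ ?_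
    · filter_upwards [hpos] with k hk
      simp only [Function.comp]
      rw [← zpow_add₀ hk.ne']
      congr 1
      push_cast; ring
    · filter_upwards with k
      simp
  constructor
  · rintro ⟨p, rfl⟩
    have : (-(Complex.I ^ (2 * p + 1 + 3))).re = (-1 : ℝ) ^ ((2 * p + 1 + 1) / 2) := by
      rw [show (2 * p + 1 + 1) / 2 = p + 1 by omega, show 2 * p + 1 + 3 = 2 * (p + 2) by ring,
        pow_mul, Complex.I_sq]
      have : (-(-1 : ℂ) ^ (p + 2)) = (((-1 : ℝ) ^ (p + 1) : ℝ) : ℂ) := by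
        push_cast; ring
      rw [this, Complex.ofReal_re]
    rw [this] at hO
    exact hO
  · intro hj
    obtain ⟨p, rfl⟩ := even_iff_exists_two_mul.1 hj
    have : (-(Complex.I ^ (2 * p + 3))).re = 0 := by
      rw [show 2 * p + 3 = 2 * (p + 1) + 1 by ring, pow_succ,
        pow_mul, Complex.I_sq]
      have : (-((-1 : ℂ) ^ (p + 1) * Complex.I)) = (((-1 : ℝ) ^ p : ℝ) : ℂ) * Complex.I := by
        push_cast; ring
      rw [this, Complex.re_ofReal_mul]; simp
    rw [this] at hO
    simpa using hO
end

section
/- Let N ≥ 1 be an integer, 0 < ε ≤ 1/2, and 0 < R ≤ 1. Let η : (0, R) → ℝ be continuously differentiable, and suppose A := ∫_0^R η(r)² r^(−3−2N+2ε) dr < ∞ and B := ∫_0^R η'(r)² r^(−1−2N+2ε) dr < ∞. Then for every r ∈ (0, R): |η(r)| ≤ R^(N+1/2−ε) (A^(1/2) + B^(1/2)). -/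
open MeasureTheory

theorem stmt10 (N : ℕ) (hN : 1 ≤ N) (ε R : ℝ) (hε : 0 < ε) (hε' : ε ≤ 1/2)
    (hR0 : 0 < R) (hR1 : R ≤ 1) (η η' : ℝ → ℝ)
    (hderiv : ∀ r ∈ Set.Ioo (0 : ℝ) R, HasDerivAt η (η' r) r)
    (hcont : ContinuousOn η' (Set.Ioo (0 : ℝ) R))
    (hA : IntegrableOn (fun r : ℝ => (η r) ^ 2 * r ^ (-3 - 2 * (N : ℝ) + 2 * ε))
      (Set.Ioo (0 : ℝ) R))
    (hB : IntegrableOn (fun r : ℝ => (η' r) ^ 2 * r ^ (-1 - 2 * (N : ℝ) + 2 * ε))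
      (Set.Ioo (0 : ℝ) R)) :
    ∀ r ∈ Set.Ioo (0 : ℝ) R,
      |η r| ≤ R ^ ((N : ℝ) + 1/2 - ε) *
        (Real.sqrt (∫ s in Set.Ioo (0 : ℝ) R, (η s) ^ 2 * s ^ (-3 - 2 * (N : ℝ) + 2 * ε)) +
         Real.sqrt (∫ s in Set.Ioo (0 : ℝ) R, (η' s) ^ 2 * s ^ (-1 - 2 * (N : ℝ) + 2 * ε))) := by
  set e₁ : ℝ := -3 - 2 * (N : ℝ) + 2 * ε with he₁
  set e₂ : ℝ := -1 - 2 * (N : ℝ) + 2 * ε with he₂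
  have hN' : (1 : ℝ) ≤ N := by exact_mod_cast hN
  set a : ℝ := (N : ℝ) + 1/2 - ε with ha
  set A := ∫ s in Set.Ioo (0 : ℝ) R, (η s) ^ 2 * s ^ e₁ with hAdef
  set B := ∫ s in Set.Ioo (0 : ℝ) R, (η' s) ^ 2 * s ^ e₂ with hBdef
  have hA0 : 0 ≤ A := setIntegral_nonneg measurableSet_Ioo fun s hs =>
    mul_nonneg (sq_nonneg _) (Real.rpow_nonneg hs.1.le _)
  have hB0 : 0 ≤ B := setIntegral_nonneg measurableSet_Ioo fun s hs =>
    mul_nonneg (sq_nonneg _) (Real.rpow_nonneg hs.1.le _)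
  intro r hr
  have hsmall : ∀ δ > 0, ∃ s ∈ Set.Ioo (0 : ℝ) r, (η s) ^ 2 < δ := by
    intro δ hδ
    by_contra! hcon
    have hint : IntegrableOn (fun x : ℝ => x ^ e₁) (Set.Ioo 0 r) := by
      have h1 := (hA.mono_set (Set.Ioo_subset_Ioo_right hr.2.le)).const_mul (1 / δ)
      refine Integrable.mono' h1 (by fun_prop) ?_
      filter_upwards [ae_restrict_mem measurableSet_Ioo] with x hx
      have hp := Real.rpow_nonneg hx.1.le e₁
      rw [Real.norm_of_nonneg hp, ← mul_assoc]
      have : 1 ≤ 1 / δ * (η x) ^ 2 := by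
        rw [one_div, inv_mul_eq_div, le_div_iff₀ hδ]; linarith [hcon x hx]
      nlinarith
    rw [intervalIntegral.integrableOn_Ioo_rpow_iff hr.1] at hint
    linarith
  have hpt : ∀ s ∈ Set.Ioo (0 : ℝ) R,
      2 * η s * η' s ≤ R ^ (2 * a) * ((η s) ^ 2 * s ^ e₁ + (η' s) ^ 2 * s ^ e₂) := by
    intro s hs
    have hs0 := hs.1
    have q : s ^ (2 * a) ≤ R ^ (2 * a) :=
      Real.rpow_le_rpow hs0.le hs.2.le (by linarith)
    have q1 : s ^ (2 * a) * s ^ e₂ = 1 := by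
      rw [← Real.rpow_add hs0, show 2 * a + e₂ = 0 by rw [ha, he₂]; ring, Real.rpow_zero]
    have q2 : s ^ e₂ ≤ s ^ e₁ :=
      Real.rpow_le_rpow_of_exponent_ge hs0 (hs.2.le.trans hR1) (by linarith)
    have p2 := Real.rpow_nonneg hs0.le e₂
    have p0 := Real.rpow_nonneg hR0.le (2 * a)
    have q3 : 1 ≤ R ^ (2 * a) * s ^ e₂ := by rw [← q1]; gcongr
    calc 2 * η s * η' s ≤ 1 * ((η s) ^ 2 + (η' s) ^ 2) := by nlinarith [sq_nonneg (η s - η' s)]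
      _ ≤ (R ^ (2 * a) * s ^ e₂) * ((η s) ^ 2 + (η' s) ^ 2) := by gcongr
      _ = R ^ (2 * a) * ((η s) ^ 2 * s ^ e₂ + (η' s) ^ 2 * s ^ e₂) := by ring
      _ ≤ _ := by gcongr
  have hG : IntegrableOn (fun x => R ^ (2 * a) * ((η x) ^ 2 * x ^ e₁ + (η' x) ^ 2 * x ^ e₂))
      (Set.Ioo 0 R) := (hA.add hB).const_mul (R ^ (2 * a))
  have hmain : ∀ s ∈ Set.Ioo (0 : ℝ) r, (η r) ^ 2 - (η s) ^ 2 ≤ R ^ (2 * a) * (A + B) := by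
    intro s hs
    have hsub : Set.Icc s r ⊆ Set.Ioo 0 R := fun x hx =>
      ⟨hs.1.trans_le hx.1, hx.2.trans_lt hr.2⟩
    have hηc : ContinuousOn η (Set.Icc s r) := fun x hx =>
      (hderiv x (hsub hx)).continuousAt.continuousWithinAt
    have hc : ContinuousOn (fun x => 2 * η x * η' x) (Set.Icc s r) :=
      (continuousOn_const.mul hηc).mul (hcont.mono hsub)
    have hi := hc.intervalIntegrable_of_Icc (μ := volume) hs.2.le
    have hft := intervalIntegral.integral_eq_sub_of_hasDerivAt (f := fun x => (η x) ^ 2)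
      (f' := fun x => 2 * η x * η' x) (a := s) (b := r) (fun x hx => by
        rw [Set.uIcc_of_le hs.2.le] at hx
        have h := (hderiv x (hsub hx)).fun_pow 2
        simp only [Nat.cast_ofNat, Nat.add_one_sub_one, pow_one] at h
        exact h) hi
    rw [← hft, intervalIntegral.integral_of_le hs.2.le]
    have hsub' : Set.Ioc s r ⊆ Set.Ioo 0 R := Set.Ioc_subset_Icc_self.trans hsub
    calc _ ≤ ∫ x in Set.Ioc s r, R ^ (2 * a) * ((η x) ^ 2 * x ^ e₁ + (η' x) ^ 2 * x ^ e₂) :=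
          setIntegral_mono_on (hc.integrableOn_Icc.mono_set Set.Ioc_subset_Icc_self)
            (IntegrableOn.mono_set hG hsub') measurableSet_Ioc fun x hx => hpt x (hsub' hx)
      _ ≤ ∫ x in Set.Ioo 0 R, R ^ (2 * a) * ((η x) ^ 2 * x ^ e₁ + (η' x) ^ 2 * x ^ e₂) := by
          refine setIntegral_mono_set hG ?_ hsub'.eventuallyLE
          filter_upwards [ae_restrict_mem measurableSet_Ioo] with x hx
          have p1 := Real.rpow_nonneg hx.1.le e₁
          have p2 := Real.rpow_nonneg hx.1.le e₂
          have p0 := Real.rpow_nonneg hR0.le (2 * a)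
          simp only [Pi.zero_apply]
          positivity
      _ = R ^ (2 * a) * (A + B) := by
          rw [integral_const_mul, integral_add hA hB]
  have hsq : (η r) ^ 2 ≤ R ^ (2 * a) * (A + B) := by
    refine le_of_forall_pos_le_add fun δ hδ => ?_
    obtain ⟨s, hs, h⟩ := hsmall δ hδ
    linarith [hmain s hs]
  have hRa := Real.rpow_nonneg hR0.le a
  refine abs_le_of_sq_le_sq ?_ (mul_nonneg hRa (add_nonneg (Real.sqrt_nonneg _) (Real.sqrt_nonneg _)))
  have h2 : R ^ (2 * a) = (R ^ a) ^ 2 := by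
    rw [mul_comm, Real.rpow_mul hR0.le]; norm_num
  rw [h2] at hsq
  rw [mul_pow]
  refine hsq.trans ?_
  gcongr
  nlinarith [Real.sq_sqrt hA0, Real.sq_sqrt hB0, Real.sqrt_nonneg A, Real.sqrt_nonneg B,
    mul_nonneg (Real.sqrt_nonneg A) (Real.sqrt_nonneg B)]
end

section
/- Let R > 0 and let η : ℝ → ℝ be continuously differentiable on the closed interval [0, R]. Then for every r ∈ [0, R]: η(r)² ≤ (1/R) ∫_0^R η(s)² ds + 2 ( ∫_0^R η(s)² ds )^(1/2) ( ∫_0^R η'(s)² ds )^(1/2). -/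
open MeasureTheory intervalIntegral

theorem stmt11 (R : ℝ) (hR : 0 < R) (η η' : ℝ → ℝ)
    (hderiv : ∀ r ∈ Set.Icc (0 : ℝ) R, HasDerivAt η (η' r) r)
    (hcont : ContinuousOn η' (Set.Icc (0 : ℝ) R)) :
    ∀ r ∈ Set.Icc (0 : ℝ) R,
      (η r) ^ 2 ≤ (1 / R) * (∫ s in (0 : ℝ)..R, (η s) ^ 2)
        + 2 * Real.sqrt (∫ s in (0 : ℝ)..R, (η s) ^ 2) *
            Real.sqrt (∫ s in (0 : ℝ)..R, (η' s) ^ 2) := by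
  intro r hr
  have hη : ContinuousOn η (Set.Icc (0 : ℝ) R) :=
    fun x hx => (hderiv x hx).continuousAt.continuousWithinAt
  have hu : Set.uIcc (0 : ℝ) R = Set.Icc 0 R := Set.uIcc_of_le hR.le
  have ii : ∀ f : ℝ → ℝ, ContinuousOn f (Set.Icc (0 : ℝ) R) →
      IntervalIntegrable f volume 0 R := fun f hf =>
    ContinuousOn.intervalIntegrable (by rw [hu]; exact hf)
  have iA := ii (fun s => (η s) ^ 2) (hη.pow 2)
  have iB := ii (fun s => (η' s) ^ 2) (hcont.pow 2)
  have iP := ii (fun s => |η s * η' s|) (hη.mul hcont).abs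
  set A := ∫ s in (0 : ℝ)..R, (η s) ^ 2 with hA
  set B := ∫ s in (0 : ℝ)..R, (η' s) ^ 2 with hB
  set P := ∫ s in (0 : ℝ)..R, |η s * η' s| with hP
  have hA0 : 0 ≤ A := integral_nonneg hR.le fun s _ => sq_nonneg _
  have hPAB : P ≤ Real.sqrt A * Real.sqrt B := by
    rw [← Real.sqrt_mul hA0]
    apply Real.le_sqrt_of_sq_le
    have hd : discrim A (-(2 * P)) B ≤ 0 := by
      apply discrim_le_zero
      intro t
      have h0 : 0 ≤ ∫ s in (0 : ℝ)..R, (t * |η s| - |η' s|) ^ 2 :=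
        integral_nonneg hR.le fun s _ => sq_nonneg _
      have he : ∫ s in (0 : ℝ)..R, (t * |η s| - |η' s|) ^ 2
          = t ^ 2 * A - 2 * t * P + B := by
        rw [hA, hB, hP, ← intervalIntegral.integral_const_mul,
          ← intervalIntegral.integral_const_mul,
          ← intervalIntegral.integral_sub (iA.const_mul _) (iP.const_mul _),
          ← intervalIntegral.integral_add ((iA.const_mul _).sub (iP.const_mul _)) iB]
        congr 1
        funext s
        rw [abs_mul, ← sq_abs (η s), ← sq_abs (η' s)]
        ring
      rw [he] at h0
      linarith
    unfold discrim at hd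
    nlinarith
  have key : ∀ s ∈ Set.Icc (0 : ℝ) R, (η r) ^ 2 - 2 * P ≤ (η s) ^ 2 := by
    intro s hs
    have hsub : Set.uIcc s r ⊆ Set.Icc 0 R := Set.ordConnected_Icc.uIcc_subset hs hr
    have hftc : ∫ x in s..r, 2 * (η x * η' x) = (η r) ^ 2 - (η s) ^ 2 := by
      apply integral_eq_sub_of_hasDerivAt (f := fun x => (η x) ^ 2)
      · intro x hx
        have := (hderiv x (hsub hx)).pow 2
        have e : 2 * (η x * η' x) = ((2 : ℕ) : ℝ) * η x ^ (2 - 1) * η' x := by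
          norm_num
          ring
        rw [e]
        exact this
      · exact ((continuousOn_const.mul (hη.mul hcont)).mono hsub).intervalIntegrable
    rw [intervalIntegral.integral_const_mul] at hftc
    have h1 : |∫ x in s..r, η x * η' x| ≤ P := by
      calc |∫ x in s..r, η x * η' x| ≤ |(∫ x in s..r, |η x * η' x|)| :=
            intervalIntegral.norm_integral_le_abs_integral_norm
              (f := fun x => η x * η' x) (a := s) (b := r) (μ := volume)
        _ ≤ |P| := by
            apply intervalIntegral.abs_integral_mono_interval _ _ iP
            · rw [Set.uIoc_of_le hR.le]
              exact Set.Ioc_subset_Ioc (le_min hs.1 hr.1) (max_le hs.2 hr.2)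
            · exact Filter.Eventually.of_forall fun x => abs_nonneg _
        _ = P := abs_of_nonneg (integral_nonneg hR.le fun s _ => abs_nonneg _)
    have := le_abs_self (∫ x in s..r, η x * η' x)
    linarith
  have hint : ∫ s in (0 : ℝ)..R, ((η r) ^ 2 - 2 * P) ≤ A :=
    integral_mono_on hR.le (by simp) iA key
  rw [intervalIntegral.integral_const, smul_eq_mul, sub_zero] at hint
  have : (η r) ^ 2 - 2 * P ≤ 1 / R * A := by
    rw [one_div, inv_mul_eq_div, le_div_iff₀ hR]
    linarith
  linarith
end
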